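/- arXiv:1107.5968 — 3 statements merged into one kernel-verified Lean document; each statement's English description precedes it below -/
import Mathlib

section
/- Consider the linear time-varying system ẋ(t) = A(t)x(t) + G(t)w(t) with x(t₀) = 0 and output y(t) = C(t)x(t) on Ω = [t₀, t₀+T]. Let W : Ω → ℝ^{n×n} be the solution of the differential Lyapunov equation Ẇ(t) = A(t)W(t) + W(t)A(t)ᵀ + G(t)R(t)⁻¹G(t)ᵀ with W(t₀) = 0. If the system is IO-FTS with respect to (W₂, Q(·), Ω), i.e. every input w ∈ W₂ produces an output with y(t)ᵀQ(t)y(t) < 1 for all t ∈ Ω, then λ_max(Q(t)^{1/2} C(t) W(t) C(t)ᵀ Q(t)^{1/2}) < 1 for every t ∈ Ω. -/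
open MeasureTheory Matrix Set

lemma aux_ode_fwd {n : ℕ} (a b : ℝ) (hab : a ≤ b)
    (B : ℝ → (Fin n → ℝ) →L[ℝ] (Fin n → ℝ)) (hB : ContinuousOn B (Icc a b)) (v : Fin n → ℝ) :
    ∃ p : ℝ → Fin n → ℝ, p a = v ∧
      ∀ t ∈ Icc a b, HasDerivWithinAt p (B t (p t)) (Icc a b) t := by
  obtain ⟨K, hK⟩ := isCompact_Icc.exists_bound_of_continuousOn hB
  have hK0 : 0 ≤ K := (norm_nonneg _).trans (hK a ⟨le_rfl, hab⟩)
  set M : ℝ := ‖v‖ * Real.exp (K * (b - a)) with hM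
  have hM0 : 0 ≤ M := by positivity
  set c : (Fin n → ℝ) → (Fin n → ℝ) := fun x i => max (-M) (min M (x i)) with hc
  have hcL : LipschitzWith 1 c := by
    refine LipschitzWith.of_dist_le_mul fun x y => ?_
    rw [NNReal.coe_one, one_mul]
    refine (dist_pi_le_iff dist_nonneg).2 fun i => ?_
    have h := ((LipschitzWith.id (α := ℝ)).const_min M).const_max (-M)
    have := h.dist_le_mul (x i) (y i)
    rw [NNReal.coe_one, one_mul] at this
    exact this.trans (dist_le_pi_dist x y i)
  have hc0 : c 0 = 0 := by
    ext i; simp [hc, hM0]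
  have hcn : ∀ x, ‖c x‖ ≤ ‖x‖ := fun x => by
    have := hcL.dist_le_mul x 0
    simpa [hc0] using this
  have hcM : ∀ x, ‖c x‖ ≤ M := fun x => by
    refine (pi_norm_le_iff_of_nonneg hM0).2 fun i => ?_
    rw [Real.norm_eq_abs, abs_le]
    exact ⟨le_max_left _ _, max_le (by linarith) (min_le_left _ _)⟩
  have hcid : ∀ x, ‖x‖ ≤ M → c x = x := fun x hx => by
    ext i
    have := abs_le.1 (((norm_le_pi_norm x i).trans hx))
    simp [hc, this.1, this.2]
  have hPL : IsPicardLindelof (fun t x => B t (c x)) (tmin := a) (tmax := b) ⟨a, le_rfl, hab⟩ v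
      (⟨K * M * (b - a), mul_nonneg (by positivity) (sub_nonneg.2 hab)⟩) 0 ⟨K * M, by positivity⟩
      ⟨K, hK0⟩ := by
    refine ⟨fun t ht => ?_, fun x _ => ?_, fun t ht x _ => ?_, ?_⟩
    · refine LipschitzWith.lipschitzOnWith ?_
      refine LipschitzWith.of_dist_le_mul fun x y => ?_
      rw [dist_eq_norm, ← map_sub]
      refine ((B t).le_opNorm _).trans ?_
      have h1 := hcL.dist_le_mul x y
      rw [NNReal.coe_one, one_mul, dist_eq_norm] at h1
      exact mul_le_mul (hK t ht) h1 (norm_nonneg _) hK0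
    · exact hB.clm_apply continuousOn_const
    · exact ((B t).le_opNorm _).trans (mul_le_mul (hK t ht) (hcM x) (norm_nonneg _) hK0)
    · simp only [NNReal.coe_mk, sub_self, NNReal.coe_zero, sub_zero, max_eq_left (sub_nonneg.2 hab)]
      exact le_rfl
  obtain ⟨p, hp0, hp⟩ := hPL.exists_eq_forall_mem_Icc_hasDerivWithinAt₀
  refine ⟨p, hp0, fun t ht => ?_⟩
  have hb : ‖p t‖ ≤ M := by
    have h := norm_le_gronwallBound_of_norm_deriv_right_le (f := p) (f' := fun t => B t (c (p t)))
      (δ := ‖v‖) (K := K) (ε := 0) (a := a) (b := b)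
      (fun t ht => (hp t ht).continuousWithinAt)
      (fun t ht => (hp t ⟨ht.1, ht.2.le⟩).mono_of_mem_nhdsWithin
        (Icc_mem_nhdsGE_of_mem ht)) (by rw [← hp0]) (fun t ht => by
          rw [add_zero]
          exact ((B t).le_opNorm _).trans
            (mul_le_mul (hK t ⟨ht.1, ht.2.le⟩) (hcn _) (norm_nonneg _) hK0)) t ht
    rw [gronwallBound_ε0] at h
    refine h.trans ?_
    rw [hM]
    have := ht.2
    gcongr
  have := hp t ht
  simpa only [hcid _ hb] using this

lemma aux_ode_bwd {n : ℕ} (a b : ℝ) (hab : a ≤ b)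
    (B : ℝ → (Fin n → ℝ) →L[ℝ] (Fin n → ℝ)) (hB : ContinuousOn B (Icc a b)) (v : Fin n → ℝ) :
    ∃ p : ℝ → Fin n → ℝ, p b = v ∧
      ∀ t ∈ Icc a b, HasDerivWithinAt p (B t (p t)) (Icc a b) t := by
  have hm : MapsTo (fun s : ℝ => a + b - s) (Icc a b) (Icc a b) := fun s hs =>
    ⟨by linarith [hs.2], by linarith [hs.1]⟩
  obtain ⟨q, hq0, hq⟩ := aux_ode_fwd a b hab (fun s => - B (a + b - s))
    ((hB.comp (by fun_prop) hm).neg) v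
  refine ⟨fun s => q (a + b - s), by simp [hq0], fun t ht => ?_⟩
  have h1 : HasDerivWithinAt (fun s : ℝ => a + b - s) (-1) (Icc a b) t := by
    simpa using (hasDerivWithinAt_id t (Icc a b)).const_sub (a + b)
  have h := (hq _ (hm ht)).scomp t h1 hm
  simpa [Function.comp_def] using h

lemma aux_ftc {E : Type*} [NormedAddCommGroup E] [NormedSpace ℝ E] [CompleteSpace E]
    (a b : ℝ) (hab : a ≤ b) (f f' : ℝ → E)
    (hf : ∀ s ∈ Icc a b, HasDerivWithinAt f (f' s) (Icc a b) s)
    (hf' : ContinuousOn f' (Icc a b)) :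
    IntervalIntegrable f' volume a b ∧ ∫ s in a..b, f' s = f b - f a := by
  have hi : IntervalIntegrable f' volume a b := hf'.intervalIntegrable_of_Icc hab
  refine ⟨hi, intervalIntegral.integral_eq_sub_of_hasDerivAt_of_le hab
    (fun s hs => (hf s hs).continuousWithinAt)
    (fun s hs => (hf s ⟨hs.1.le, hs.2.le⟩).hasDerivAt (Icc_mem_nhds hs.1 hs.2)) hi⟩

lemma aux_congr {E : Type*} [NormedAddCommGroup E] [NormedSpace ℝ E] {a b : ℝ} {f g : ℝ → E}
    (h : EqOn f g (uIoc a b)) : ∫ s in a..b, f s = ∫ s in a..b, g s :=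
  intervalIntegral.integral_congr_ae (Filter.Eventually.of_forall fun _ hx => h hx)

open Classical in
lemma aux_glue {E : Type*} [NormedAddCommGroup E] [NormedSpace ℝ E] [CompleteSpace E]
    (a t b : ℝ) (hat : a ≤ t) (f f' g g' h' : ℝ → E)
    (hf : ∀ s ∈ Icc a t, HasDerivWithinAt f (f' s) (Icc a t) s)
    (hf' : ContinuousOn f' (Icc a t))
    (hg : ∀ s ∈ Icc t b, HasDerivWithinAt g (g' s) (Icc t b) s)
    (hg' : ContinuousOn g' (Icc t b)) (hfg : f t = g t)
    (hh1 : ∀ s ∈ Icc a t, h' s = f' s) (hh2 : ∀ s ∈ Ioc t b, h' s = g' s) :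
    ∀ s ∈ Icc a b, IntervalIntegrable h' volume a s ∧
      ∫ τ in a..s, h' τ = (if s ∈ Icc a t then f s else g s) - f a := by
  have key1 : ∀ s ∈ Icc a t, IntervalIntegrable h' volume a s ∧
      ∫ τ in a..s, h' τ = f s - f a := by
    intro s hs
    have hsub : Icc a s ⊆ Icc a t := Icc_subset_Icc_right hs.2
    have h := aux_ftc a s hs.1 f f' (fun τ hτ => (hf τ (hsub hτ)).mono hsub) (hf'.mono hsub)
    have he : EqOn f' h' (uIoc a s) := fun τ hτ => by
      rw [uIoc_of_le hs.1] at hτ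
      exact (hh1 τ (hsub ⟨hτ.1.le, hτ.2⟩)).symm
    exact ⟨h.1.congr he, by
      rw [← h.2]; exact (aux_congr he).symm⟩
  intro s hs
  by_cases hst : s ∈ Icc a t
  · rw [if_pos hst]; exact key1 s hst
  · have hts : t < s := by
      by_contra hcon
      exact hst ⟨hs.1, not_lt.1 hcon⟩
    rw [if_neg hst]
    have k := key1 t ⟨hat, le_rfl⟩
    have hsub : Icc t s ⊆ Icc t b := Icc_subset_Icc_right hs.2
    have h := aux_ftc t s hts.le g g' (fun τ hτ => (hg τ (hsub hτ)).mono hsub) (hg'.mono hsub)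
    have he : EqOn g' h' (uIoc t s) := fun τ hτ => by
      rw [uIoc_of_le hts.le] at hτ
      exact (hh2 τ ⟨hτ.1, hτ.2.trans hs.2⟩).symm
    have hi := h.1.congr he
    refine ⟨k.1.trans hi, ?_⟩
    rw [← intervalIntegral.integral_add_adjacent_intervals k.1 hi, k.2,
      ← aux_congr he, h.2, hfg]
    abel

lemma aux_cont_mat {k l : ℕ} {S : Set ℝ} {A : ℝ → Matrix (Fin k) (Fin l) ℝ}
    (hA : ∀ i j, ContinuousOn (fun t => A t i j) S) : ContinuousOn A S :=
  continuousOn_pi.2 fun i => continuousOn_pi.2 fun j => hA i j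

lemma aux_cont_mulVec {k l : ℕ} {S : Set ℝ} {A : ℝ → Matrix (Fin k) (Fin l) ℝ} {x : ℝ → Fin l → ℝ}
    (hA : ContinuousOn A S) (hx : ContinuousOn x S) : ContinuousOn (fun t => A t *ᵥ x t) S :=
  (Continuous.matrix_mulVec (A := fun q : Matrix (Fin k) (Fin l) ℝ × (Fin l → ℝ) => q.1)
    (B := fun q => q.2) continuous_fst continuous_snd).comp_continuousOn (hA.prodMk hx)

lemma aux_cont_dot {k : ℕ} {S : Set ℝ} {x y : ℝ → Fin k → ℝ}
    (hx : ContinuousOn x S) (hy : ContinuousOn y S) : ContinuousOn (fun t => x t ⬝ᵥ y t) S :=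
  (Continuous.dotProduct (A := fun q : (Fin k → ℝ) × (Fin k → ℝ) => q.1)
    (B := fun q => q.2) continuous_fst continuous_snd).comp_continuousOn (hx.prodMk hy)

lemma aux_cont_transpose {k l : ℕ} {S : Set ℝ} {A : ℝ → Matrix (Fin k) (Fin l) ℝ}
    (hA : ContinuousOn A S) : ContinuousOn (fun t => (A t)ᵀ) S :=
  (continuous_id.matrix_transpose).comp_continuousOn hA

lemma aux_cont_inv {k : ℕ} {S : Set ℝ} {A : ℝ → Matrix (Fin k) (Fin k) ℝ}
    (hA : ContinuousOn A S) (hpd : ∀ t ∈ S, (A t).PosDef) : ContinuousOn (fun t => (A t)⁻¹) S := by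
  have h : (fun t => (A t)⁻¹) = fun t => ((A t).det)⁻¹ • (A t).adjugate := by
    ext1 t
    rw [Matrix.inv_def, Ring.inverse_eq_inv']
  rw [h]
  have hd : ContinuousOn (fun t => (A t).det) S :=
    (continuous_id.matrix_det).comp_continuousOn hA
  have ha : ContinuousOn (fun t => (A t).adjugate) S :=
    (continuous_id.matrix_adjugate).comp_continuousOn hA
  exact (hd.inv₀ fun t ht => (hpd t ht).det_pos.ne').smul ha

lemma aux_clm {k : ℕ} {S : Set ℝ} {A : ℝ → Matrix (Fin k) (Fin k) ℝ} (hA : ContinuousOn A S) :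
    ∃ B : ℝ → (Fin k → ℝ) →L[ℝ] (Fin k → ℝ), ContinuousOn B S ∧ ∀ t x, B t x = A t *ᵥ x := by
  let L : Matrix (Fin k) (Fin k) ℝ →ₗ[ℝ] ((Fin k → ℝ) →L[ℝ] (Fin k → ℝ)) :=
    (LinearMap.toContinuousLinearMap.toLinearMap).comp (Matrix.toLin'.toLinearMap)
  refine ⟨fun t => L (A t), L.continuous_of_finiteDimensional.comp_continuousOn hA, fun t x => ?_⟩
  simp [L]

lemma aux_deriv_dot {k : ℕ} {S : Set ℝ} {t : ℝ} {x y : ℝ → Fin k → ℝ} {x' y' : Fin k → ℝ}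
    (hx : HasDerivWithinAt x x' S t) (hy : HasDerivWithinAt y y' S t) :
    HasDerivWithinAt (fun s => x s ⬝ᵥ y s) (x' ⬝ᵥ y t + x t ⬝ᵥ y') S t := by
  rw [hasDerivWithinAt_pi] at hx hy
  simp only [dotProduct, ← Finset.sum_add_distrib]
  exact HasDerivWithinAt.fun_sum fun i _ => (hx i).mul (hy i)

lemma aux_deriv_mulVec {k l : ℕ} {S : Set ℝ} {t : ℝ} {W : ℝ → Matrix (Fin k) (Fin l) ℝ}
    {W' : Matrix (Fin k) (Fin l) ℝ} {y : ℝ → Fin l → ℝ} {y' : Fin l → ℝ}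
    (hW : ∀ i j, HasDerivWithinAt (fun s => W s i j) (W' i j) S t)
    (hy : HasDerivWithinAt y y' S t) :
    HasDerivWithinAt (fun s => W s *ᵥ y s) (W' *ᵥ y t + W t *ᵥ y') S t := by
  rw [hasDerivWithinAt_pi]
  intro i
  exact aux_deriv_dot (x := fun s => W s i) (x' := W' i) (hasDerivWithinAt_pi.2 (hW i)) hy

lemma aux_dot_transpose {k l : ℕ} (M : Matrix (Fin k) (Fin l) ℝ) (x : Fin l → ℝ) (y : Fin k → ℝ) :
    (Mᵀ *ᵥ y) ⬝ᵥ x = y ⬝ᵥ (M *ᵥ x) := by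
  rw [mulVec_transpose, dotProduct_mulVec]

/-- **Necessity of the Gramian eigenvalue condition for IO-FTS w.r.t. W₂ inputs.**
If the system `ẋ = A x + G w`, `x(t₀) = 0`, `y = C x` is IO-FTS with respect to
`(W₂, Q(·), Ω)` on `Ω = [t₀, t₀+T]`, and `W` solves the differential Lyapunov equation
`Ẇ(t) = A(t)W(t) + W(t)A(t)ᵀ + G(t)R(t)⁻¹G(t)ᵀ`, `W(t₀) = 0`, then
`λ_max(Q(t)^{1/2} C(t) W(t) C(t)ᵀ Q(t)^{1/2}) < 1` for every `t ∈ Ω`. -/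
theorem gramian_eigenvalue_lt_one_of_io_fts
    {n r m : ℕ} (t₀ T : ℝ) (hT : 0 < T)
    (A : ℝ → Matrix (Fin n) (Fin n) ℝ)
    (G : ℝ → Matrix (Fin n) (Fin r) ℝ)
    (C : ℝ → Matrix (Fin m) (Fin n) ℝ)
    (R : ℝ → Matrix (Fin r) (Fin r) ℝ)
    (Q : ℝ → Matrix (Fin m) (Fin m) ℝ)
    (hA : ∀ i j, ContinuousOn (fun t => A t i j) (Icc t₀ (t₀ + T)))
    (hG : ∀ i j, ContinuousOn (fun t => G t i j) (Icc t₀ (t₀ + T)))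
    (hC : ∀ i j, ContinuousOn (fun t => C t i j) (Icc t₀ (t₀ + T)))
    (hR : ∀ i j, ContinuousOn (fun t => R t i j) (Icc t₀ (t₀ + T)))
    (hQ : ∀ i j, ContinuousOn (fun t => Q t i j) (Icc t₀ (t₀ + T)))
    (hRpd : ∀ t ∈ Icc t₀ (t₀ + T), (R t).PosDef)
    (hQpd : ∀ t ∈ Icc t₀ (t₀ + T), (Q t).PosDef)
    -- `W` is the solution of the differential Lyapunov equation with `W(t₀) = 0`
    (W : ℝ → Matrix (Fin n) (Fin n) ℝ)
    (hW0 : W t₀ = 0)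
    (hWode : ∀ t ∈ Icc t₀ (t₀ + T), ∀ i j,
      HasDerivWithinAt (fun s => W s i j)
        ((A t * W t + W t * (A t)ᵀ + G t * (R t)⁻¹ * (G t)ᵀ) i j)
        (Icc t₀ (t₀ + T)) t)
    -- `Qs t` is the symmetric positive definite square root of `Q t`
    (Qs : ℝ → Matrix (Fin m) (Fin m) ℝ)
    (hQs : ∀ t ∈ Icc t₀ (t₀ + T), (Qs t).PosDef ∧ Qs t * Qs t = Q t)
    -- IO-FTS with respect to `(W₂, Q(·), Ω)`
    (hIOFTS : ∀ w : ℝ → Fin r → ℝ, Measurable w →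
      IntervalIntegrable (fun τ => w τ ⬝ᵥ (R τ *ᵥ w τ)) volume t₀ (t₀ + T) →
      (∫ τ in t₀..(t₀ + T), w τ ⬝ᵥ (R τ *ᵥ w τ)) ≤ 1 →
      ∀ x : ℝ → Fin n → ℝ,
        (∀ t ∈ Icc t₀ (t₀ + T),
          IntervalIntegrable (fun τ => A τ *ᵥ x τ + G τ *ᵥ w τ) volume t₀ t ∧
          x t = ∫ τ in t₀..t, (A τ *ᵥ x τ + G τ *ᵥ w τ)) →
        ∀ t ∈ Icc t₀ (t₀ + T), (C t *ᵥ x t) ⬝ᵥ (Q t *ᵥ (C t *ᵥ x t)) < 1) :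
    -- the eigenvalue condition: `λ_max(Q^{1/2} C W Cᵀ Q^{1/2}) < 1` on `Ω`
    ∀ t ∈ Icc t₀ (t₀ + T),
      ∀ hHerm : (Qs t * C t * W t * (C t)ᵀ * Qs t).IsHermitian,
        ∀ i, hHerm.eigenvalues i < 1 := by
  classical
  intro t ht hHerm i
  by_contra hcon
  rw [not_lt] at hcon
  set lam := hHerm.eigenvalues i with hlam
  have hlam0 : 0 < lam := by linarith
  obtain ⟨v, hv, hvv⟩ : ∃ v : Fin m → ℝ,
      (Qs t * C t * W t * (C t)ᵀ * Qs t) *ᵥ v = lam • v ∧ v ⬝ᵥ v = 1 := by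
    refine ⟨⇑(hHerm.eigenvectorBasis i), hHerm.mulVec_eigenvectorBasis i, ?_⟩
    have h1 := hHerm.eigenvectorBasis.orthonormal.1 i
    have h2 := EuclideanSpace.real_norm_sq_eq (hHerm.eigenvectorBasis i)
    rw [h1] at h2
    simp only [dotProduct, ← pow_two]
    linarith
  obtain ⟨c, hc⟩ : ∃ c : ℝ, c * c * lam = 1 :=
    ⟨(Real.sqrt lam)⁻¹, by
      rw [← mul_inv, Real.mul_self_sqrt hlam0.le, inv_mul_cancel₀ hlam0.ne']⟩
  have hA' := aux_cont_mat hA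
  have hG' := aux_cont_mat hG
  have hR' := aux_cont_mat hR
  have hRi := aux_cont_inv hR' hRpd
  have hs1 : Icc t₀ t ⊆ Icc t₀ (t₀ + T) := Icc_subset_Icc_right ht.2
  have hs2 : Icc t (t₀ + T) ⊆ Icc t₀ (t₀ + T) := Icc_subset_Icc_left ht.1
  -- the adjoint state
  obtain ⟨p, hpt, hp⟩ : ∃ p : ℝ → Fin n → ℝ, p t = c • ((C t)ᵀ *ᵥ (Qs t *ᵥ v)) ∧
      ∀ s ∈ Icc t₀ t, HasDerivWithinAt p (-((A s)ᵀ *ᵥ p s)) (Icc t₀ t) s := by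
    obtain ⟨B, hBc, hB⟩ := aux_clm (aux_cont_transpose (hA'.mono hs1)).neg
    obtain ⟨p, h1, h2⟩ := aux_ode_bwd t₀ t ht.1 B hBc (c • ((C t)ᵀ *ᵥ (Qs t *ᵥ v)))
    refine ⟨p, h1, fun s hs => ?_⟩
    have := h2 s hs
    rw [hB, Pi.neg_apply, neg_mulVec] at this
    exact this
  obtain ⟨z, hzt, hz⟩ : ∃ z : ℝ → Fin n → ℝ, z t = W t *ᵥ p t ∧
      ∀ s ∈ Icc t (t₀ + T), HasDerivWithinAt z (A s *ᵥ z s) (Icc t (t₀ + T)) s := by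
    obtain ⟨B, hBc, hB⟩ := aux_clm (hA'.mono hs2)
    obtain ⟨p, h1, h2⟩ := aux_ode_fwd t (t₀ + T) ht.2 B hBc (W t *ᵥ p t)
    refine ⟨p, h1, fun s hs => ?_⟩
    have := h2 s hs
    rw [hB] at this
    exact this
  have hpc : ContinuousOn p (Icc t₀ t) := fun s hs => (hp s hs).continuousWithinAt
  have hzc : ContinuousOn z (Icc t (t₀ + T)) := fun s hs => (hz s hs).continuousWithinAt
  have hWc : ContinuousOn W (Icc t₀ (t₀ + T)) :=
    aux_cont_mat fun i j s hs => (hWode s hs i j).continuousWithinAt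
  set u : ℝ → Fin r → ℝ := fun s => (R s)⁻¹ *ᵥ ((G s)ᵀ *ᵥ p s) with hu
  have huc : ContinuousOn u (Icc t₀ t) :=
    aux_cont_mulVec (hRi.mono hs1) (aux_cont_mulVec (aux_cont_transpose (hG'.mono hs1)) hpc)
  have hRu : ∀ s ∈ Icc t₀ t, R s *ᵥ u s = (G s)ᵀ *ᵥ p s := fun s hs => by
    have hdet : IsUnit (R s).det := (hRpd s (hs1 hs)).det_pos.ne'.isUnit
    simp only [hu]
    rw [mulVec_mulVec, Matrix.mul_nonsing_inv _ hdet, one_mulVec]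
  have hx1 : ∀ s ∈ Icc t₀ t, HasDerivWithinAt (fun s => W s *ᵥ p s)
      (A s *ᵥ (W s *ᵥ p s) + G s *ᵥ u s) (Icc t₀ t) s := fun s hs => by
    have h := aux_deriv_mulVec (fun i j => (hWode s (hs1 hs) i j).mono hs1) (hp s hs)
    convert h using 1
    simp only [hu, add_mulVec, mulVec_neg, mulVec_mulVec, Matrix.mul_assoc]
    abel
  have hx1c : ContinuousOn (fun s => W s *ᵥ p s) (Icc t₀ t) := aux_cont_mulVec (hWc.mono hs1) hpc
  have hE : ∀ s ∈ Icc t₀ t, HasDerivWithinAt (fun s => p s ⬝ᵥ (W s *ᵥ p s))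
      (u s ⬝ᵥ (R s *ᵥ u s)) (Icc t₀ t) s := fun s hs => by
    have h := aux_deriv_dot (hp s hs) (hx1 s hs)
    convert h using 1
    rw [hRu s hs, dotProduct_comm (u s), aux_dot_transpose, neg_dotProduct, aux_dot_transpose,
      dotProduct_add]
    ring
  set w : ℝ → Fin r → ℝ := (Icc t₀ t).piecewise u (fun _ => 0) with hw
  have hw1 : ∀ s ∈ Icc t₀ t, w s = u s := fun s hs => piecewise_eq_of_mem _ _ _ hs
  have hw2 : ∀ s ∉ Icc t₀ t, w s = 0 := fun s hs => piecewise_eq_of_notMem _ _ _ hs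
  have hwm : Measurable w := huc.measurable_piecewise continuousOn_const measurableSet_Icc
  have hen := aux_glue t₀ t (t₀ + T) ht.1 (fun s => p s ⬝ᵥ (W s *ᵥ p s))
    (fun s => u s ⬝ᵥ (R s *ᵥ u s)) (fun _ => p t ⬝ᵥ (W t *ᵥ p t)) (fun _ => 0)
    (fun s => w s ⬝ᵥ (R s *ᵥ w s)) hE
    (aux_cont_dot huc (aux_cont_mulVec (hR'.mono hs1) huc))
    (fun s _ => hasDerivWithinAt_const _ _ _) continuousOn_const rfl
    (fun s hs => by simp only [hw1 s hs])
    (fun s hs => by simp [hw2 s (fun h => absurd h.2 (not_le.2 hs.1))])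
    (t₀ + T) ⟨by linarith, le_rfl⟩
  have hpWp : p t ⬝ᵥ (W t *ᵥ p t) = 1 := by
    have hq : ((Qs t)ᵀ) = Qs t := by simpa using! (hQs t ht).1.isHermitian
    rw [hpt, mulVec_smul, smul_dotProduct, dotProduct_smul, aux_dot_transpose,
      ← hq, aux_dot_transpose, hq]
    simp only [mulVec_mulVec, ← Matrix.mul_assoc]
    rw [hv, dotProduct_smul, hvv]
    simp only [smul_eq_mul]
    linarith
  have hen1 : (∫ τ in t₀..(t₀ + T), w τ ⬝ᵥ (R τ *ᵥ w τ)) = 1 := by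
    rw [hen.2]
    have h0 : p t₀ ⬝ᵥ (W t₀ *ᵥ p t₀) = 0 := by rw [hW0]; simp
    split_ifs with h
    · have : t₀ + T = t := le_antisymm h.2 ht.2
      rw [h0, this, hpWp, sub_zero]
    · rw [h0, hpWp, sub_zero]
  have hfin := hIOFTS w hwm hen.1 hen1.le
    (fun s => if s ∈ Icc t₀ t then W s *ᵥ p s else z s) (fun s hs => by
      have h := aux_glue t₀ t (t₀ + T) ht.1 (fun s => W s *ᵥ p s)
        (fun s => A s *ᵥ (W s *ᵥ p s) + G s *ᵥ u s) z (fun s => A s *ᵥ z s)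
        (fun τ => A τ *ᵥ (if τ ∈ Icc t₀ t then W τ *ᵥ p τ else z τ) + G τ *ᵥ w τ) hx1
        ((aux_cont_mulVec (hA'.mono hs1) hx1c).add (aux_cont_mulVec (hG'.mono hs1) huc))
        hz (aux_cont_mulVec (hA'.mono hs2) hzc) hzt.symm
        (fun s hs => by simp only [hw1 s hs, if_pos hs])
        (fun s hs => by
          have hn : s ∉ Icc t₀ t := fun h => absurd h.2 (not_le.2 hs.1)
          simp only [hw2 s hn, if_neg hn, mulVec_zero, add_zero]) s hs
      refine ⟨h.1, ?_⟩
      rw [h.2, hW0, zero_mulVec, sub_zero]) t ht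
  have htt : t ∈ Icc t₀ t := ⟨ht.1, le_rfl⟩
  simp only [if_pos htt] at hfin
  have hq : ((Qs t)ᵀ) = Qs t := by simpa using! (hQs t ht).1.isHermitian
  have hy : Qs t *ᵥ (C t *ᵥ (W t *ᵥ p t)) = c • lam • v := by
    rw [hpt]
    simp only [mulVec_smul]
    simp only [mulVec_mulVec, ← Matrix.mul_assoc]
    rw [hv]
  rw [← (hQs t ht).2, ← mulVec_mulVec, ← aux_dot_transpose, hq, hy] at hfin
  simp only [smul_dotProduct, dotProduct_smul, hvv, smul_eq_mul] at hfin
  nlinarith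
end

section
/- Consider the linear time-varying system ẋ(t) = A(t)x(t) + G(t)w(t) with x(0) = 0 and output y(t) = C(t)x(t) on Ω = [0, T]. Let Q̃(t) = t·Q(t). Suppose there exists a continuously differentiable symmetric positive definite matrix-valued function P : Ω → ℝ^{n×n} such that for every t ∈ Ω the block matrix [[Ṗ(t) + A(t)ᵀP(t) + P(t)A(t), P(t)G(t)], [G(t)ᵀP(t), −R(t)]] is negative definite and P(t) − C(t)ᵀQ̃(t)C(t) is positive definite. Then the system is IO-FTS with respect to (W∞, Q(·), Ω): for every w ∈ W∞, the output satisfies y(t)ᵀQ(t)y(t) < 1 for all t ∈ Ω. -/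
open MeasureTheory Matrix Set

lemma aux_ac_sum {ι : Type*} (s : Finset ι) (f : ι → ℝ → ℝ) (a b : ℝ)
    (h : ∀ i ∈ s, AbsolutelyContinuousOnInterval (f i) a b) :
    AbsolutelyContinuousOnInterval (fun t => ∑ i ∈ s, f i t) a b := by
  classical
  induction s using Finset.induction_on with
  | empty =>
    simp only [Finset.sum_empty]
    exact (LipschitzWith.const (0:ℝ)).lipschitzOnWith.absolutelyContinuousOnInterval
  | insert i s hi ih =>
    simp only [Finset.sum_insert hi]
    exact (h i (Finset.mem_insert_self _ _)).add
      (ih fun j hj => h j (Finset.mem_insert_of_mem hj))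

lemma aux_quad {n r : ℕ} (A P P' : Matrix (Fin n) (Fin n) ℝ) (G : Matrix (Fin n) (Fin r) ℝ)
    (R : Matrix (Fin r) (Fin r) ℝ)
    (h : (-(Matrix.fromBlocks (P' + Aᵀ * P + P * A) (P * G) (Gᵀ * P) (-R))).PosDef)
    (z : Fin n → ℝ) (w : Fin r → ℝ) :
    (A *ᵥ z + G *ᵥ w) ⬝ᵥ (P *ᵥ z) + z ⬝ᵥ (P' *ᵥ z) + z ⬝ᵥ (P *ᵥ (A *ᵥ z + G *ᵥ w))
      ≤ w ⬝ᵥ (R *ᵥ w) := by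
  have h1 := h.posSemidef.dotProduct_mulVec_nonneg (Sum.elim z w)
  have h2 : (A *ᵥ z) ⬝ᵥ (P *ᵥ z) = z ⬝ᵥ (Aᵀ *ᵥ (P *ᵥ z)) := by
    rw [Matrix.dotProduct_mulVec z, Matrix.vecMul_transpose]
  have h3 : (G *ᵥ w) ⬝ᵥ (P *ᵥ z) = w ⬝ᵥ (Gᵀ *ᵥ (P *ᵥ z)) := by
    rw [Matrix.dotProduct_mulVec w, Matrix.vecMul_transpose]
  simp only [star_trivial, Matrix.neg_mulVec, dotProduct_neg, Matrix.fromBlocks_mulVec,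
    Sum.elim_comp_inl, Sum.elim_comp_inr, sumElim_dotProduct_sumElim, Matrix.add_mulVec,
    ← Matrix.mulVec_mulVec, dotProduct_add] at h1
  simp only [Matrix.mulVec_add, add_dotProduct, dotProduct_add, h2, h3]
  linarith

/-- **Sufficiency of the DLMI/LMI condition for IO-FTS w.r.t. W∞ inputs.**
Let `Q̃(t) = t·Q(t)`. If there is a continuously differentiable symmetric positive definite
`P(·)` such that on `Ω = [0, T]` the block matrix `[[Ṗ + AᵀP + PA, PG], [GᵀP, −R]]` is
negative definite and `P − CᵀQ̃C` is positive definite, then the system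
`ẋ = A x + G w`, `x(0) = 0`, `y = C x` is IO-FTS with respect to `(W∞, Q(·), Ω)`. -/
theorem io_fts_winf_of_dlmi
    {n r m : ℕ} (T : ℝ) (hT : 0 < T)
    (A : ℝ → Matrix (Fin n) (Fin n) ℝ)
    (G : ℝ → Matrix (Fin n) (Fin r) ℝ)
    (C : ℝ → Matrix (Fin m) (Fin n) ℝ)
    (R : ℝ → Matrix (Fin r) (Fin r) ℝ)
    (Q : ℝ → Matrix (Fin m) (Fin m) ℝ)
    (hA : ∀ i j, ContinuousOn (fun t => A t i j) (Icc 0 T))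
    (hG : ∀ i j, ContinuousOn (fun t => G t i j) (Icc 0 T))
    (hC : ∀ i j, ContinuousOn (fun t => C t i j) (Icc 0 T))
    (hR : ∀ i j, ContinuousOn (fun t => R t i j) (Icc 0 T))
    (hQ : ∀ i j, ContinuousOn (fun t => Q t i j) (Icc 0 T))
    (hRpd : ∀ t ∈ Icc (0:ℝ) T, (R t).PosDef)
    (hQpd : ∀ t ∈ Icc (0:ℝ) T, (Q t).PosDef)
    -- `P` continuously differentiable (with derivative `P'`), symmetric positive definite
    (P P' : ℝ → Matrix (Fin n) (Fin n) ℝ)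
    (hPpd : ∀ t ∈ Icc (0:ℝ) T, (P t).PosDef)
    (hP'cont : ∀ i j, ContinuousOn (fun t => P' t i j) (Icc 0 T))
    (hPderiv : ∀ t ∈ Icc (0:ℝ) T, ∀ i j,
      HasDerivWithinAt (fun s => P s i j) (P' t i j) (Icc 0 T) t)
    -- the DLMI: `[[Ṗ + AᵀP + PA, PG], [GᵀP, −R]] < 0` on `Ω`
    (hDLMI : ∀ t ∈ Icc (0:ℝ) T,
      (-(Matrix.fromBlocks (P' t + (A t)ᵀ * P t + P t * A t) (P t * G t)
          ((G t)ᵀ * P t) (-(R t)))).PosDef)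
    -- the LMI: `P > CᵀQ̃C` on `Ω`, where `Q̃(t) = t • Q(t)`
    (hLMI : ∀ t ∈ Icc (0:ℝ) T, (P t - (C t)ᵀ * (t • Q t) * C t).PosDef) :
    -- IO-FTS with respect to `(W∞, Q(·), Ω)`
    ∀ w : ℝ → Fin r → ℝ, Measurable w →
      (∀ᵐ t ∂(volume.restrict (Icc (0:ℝ) T)), w t ⬝ᵥ (R t *ᵥ w t) ≤ 1) →
      ∀ x : ℝ → Fin n → ℝ,
        (∀ t ∈ Icc (0:ℝ) T,
          IntervalIntegrable (fun τ => A τ *ᵥ x τ + G τ *ᵥ w τ) volume 0 t ∧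
          x t = ∫ τ in (0:ℝ)..t, (A τ *ᵥ x τ + G τ *ᵥ w τ)) →
        ∀ t ∈ Icc (0:ℝ) T, (C t *ᵥ x t) ⬝ᵥ (Q t *ᵥ (C t *ᵥ x t)) < 1 := by
  intro w hw hwR x hx t ht
  have hx0 : x 0 = 0 := by
    have := (hx 0 ⟨le_rfl, hT.le⟩).2
    simpa using this
  set f : ℝ → Fin n → ℝ := fun τ => A τ *ᵥ x τ + G τ *ᵥ w τ with hf
  have hfi : ∀ s ∈ Icc (0:ℝ) T, ∀ i, IntervalIntegrable (fun τ => f τ i) volume 0 s := by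
    intro s hs i
    have h := (hx s hs).1
    exact ⟨h.1.eval i, h.2.eval i⟩
  let z : Fin n → ℝ → ℝ := fun i s => ∫ τ in (0:ℝ)..s, f τ i
  have hz : ∀ s ∈ Icc (0:ℝ) T, ∀ i, x s i = z i s := by
    intro s hs i
    rw [(hx s hs).2]
    exact ((ContinuousLinearMap.proj (R := ℝ) (φ := fun _ : Fin n => ℝ) i).intervalIntegral_comp_comm
      (hx s hs).1).symm
  have huIcc : uIcc 0 t = Icc 0 t := uIcc_of_le ht.1
  have hsub : Icc 0 t ⊆ Icc 0 T := Icc_subset_Icc_right ht.2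
  have hzac : ∀ i, AbsolutelyContinuousOnInterval (z i) 0 t := fun i =>
    (hfi t ht i).absolutelyContinuousOnInterval_intervalIntegral (by simp)
  have hPac : ∀ i j, AbsolutelyContinuousOnInterval (fun s => P s i j) 0 t := by
    intro i j
    obtain ⟨K, hK⟩ := (isCompact_Icc (a := (0:ℝ)) (b := T)).exists_bound_of_continuousOn
      (hP'cont i j)
    have hL : LipschitzOnWith K.toNNReal (fun s => P s i j) (Icc 0 T) := by
      refine (convex_Icc 0 T).lipschitzOnWith_of_nnnorm_hasDerivWithin_le
        (fun s hs => hPderiv s hs i j) ?_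
      intro s hs
      rw [← NNReal.coe_le_coe, coe_nnnorm]
      exact (hK s hs).trans (Real.le_coe_toNNReal K)
    refine LipschitzOnWith.absolutelyContinuousOnInterval (K := K.toNNReal) ?_
    rw [huIcc]
    exact hL.mono hsub
  let V : ℝ → ℝ := fun s => ∑ i, ∑ j, z i s * (P s i j * z j s)
  have hVac : AbsolutelyContinuousOnInterval V 0 t := by
    refine aux_ac_sum _ _ _ _ fun i _ => ?_
    refine aux_ac_sum _ _ _ _ fun j _ => ?_
    exact (hzac i).mul ((hPac i j).mul (hzac j))
  have hVx : ∀ s ∈ Icc (0:ℝ) T, V s = x s ⬝ᵥ (P s *ᵥ x s) := by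
    intro s hs
    simp only [V, dotProduct, Matrix.mulVec, Finset.mul_sum, hz s hs]
  have hzd : ∀ᵐ s, ∀ i, s ∈ Icc 0 t → HasDerivAt (z i) (f s i) s := by
    rw [ae_all_iff]
    intro i
    filter_upwards [(hfi t ht i).ae_hasDerivAt_integral] with s hs hs'
    exact hs (huIcc ▸ hs') 0 (by simp)
  have hne : ∀ a : ℝ, ∀ᵐ s : ℝ, s ≠ a := fun a => by simp [ae_iff, measure_singleton]
  have hVd : ∀ᵐ s ∂(volume.restrict (Icc 0 t)), deriv V s ≤ 1 := by
    have hwR' := ae_restrict_of_ae_restrict_of_subset hsub hwR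
    filter_upwards [hwR', ae_restrict_of_ae hzd, ae_restrict_of_ae (hne 0),
      ae_restrict_of_ae (hne t), ae_restrict_mem measurableSet_Icc] with s h1 h2 h3 h4 h5
    have h5T := hsub h5
    have hnb : Icc 0 T ∈ nhds s :=
      Icc_mem_nhds (lt_of_le_of_ne h5.1 (Ne.symm h3)) ((lt_of_le_of_ne h5.2 h4).trans_le ht.2)
    have hPd : ∀ i j, HasDerivAt (fun s => P s i j) (P' s i j) s := fun i j =>
      (hPderiv s h5T i j).hasDerivAt hnb
    have hV : HasDerivAt V (∑ i, ∑ j, (f s i * (P s i j * z j s) +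
        z i s * (P' s i j * z j s + P s i j * f s j))) s := by
      refine HasDerivAt.fun_sum fun i _ => HasDerivAt.fun_sum fun j _ => ?_
      exact (h2 i h5).mul ((hPd i j).mul (h2 j h5))
    rw [hV.deriv]
    refine le_trans (le_of_eq ?_) ((aux_quad _ _ _ _ _ (hDLMI s h5T) (x s) (w s)).trans h1)
    change _ = f s ⬝ᵥ (P s *ᵥ x s) + x s ⬝ᵥ (P' s *ᵥ x s) + x s ⬝ᵥ (P s *ᵥ f s)
    simp only [dotProduct, Matrix.mulVec, Finset.mul_sum, hz s h5T, ← Finset.sum_add_distrib]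
    refine Finset.sum_congr rfl fun i _ => Finset.sum_congr rfl fun j _ => ?_
    ring
  have hVt : V t ≤ t := by
    have h1 := hVac.integral_deriv_eq_sub
    have h2 : ∫ s in (0:ℝ)..t, deriv V s ≤ ∫ s in (0:ℝ)..t, (1:ℝ) :=
      intervalIntegral.integral_mono_ae_restrict ht.1 hVac.intervalIntegrable_deriv
        intervalIntegrable_const hVd
    have h3 : V 0 = 0 := by simp [hVx 0 ⟨le_rfl, hT.le⟩, hx0]
    simp at h2
    linarith
  by_cases hxt : x t = 0
  · simp [hxt]
  have ht0 : 0 < t := by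
    rcases ht.1.eq_or_lt with h | h
    · exact absurd (h ▸ hx0) hxt
    · exact h
  have h1 := (hLMI t ht).dotProduct_mulVec_pos hxt
  have h2 : x t ⬝ᵥ (((C t)ᵀ * (t • Q t) * C t) *ᵥ x t)
      = t * ((C t *ᵥ x t) ⬝ᵥ (Q t *ᵥ (C t *ᵥ x t))) := by
    rw [← Matrix.mulVec_mulVec, ← Matrix.mulVec_mulVec, Matrix.dotProduct_mulVec,
      Matrix.vecMul_transpose, Matrix.smul_mulVec, dotProduct_smul, smul_eq_mul]
  rw [star_trivial, Matrix.sub_mulVec, dotProduct_sub, h2, ← hVx t ht] at h1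
  have h3 : t * ((C t *ᵥ x t) ⬝ᵥ (Q t *ᵥ (C t *ᵥ x t))) < t * 1 := by linarith
  exact lt_of_mul_lt_mul_left h3 ht0.le
end

section
/- Consider the family of time-dependent switching linear systems ẋ(t) = A_{σ(t)}(t)x(t) + G_{σ(t)}(t)w(t) for t ∉ 𝒯, x(t⁺) = J(t)x(t) for t ∈ 𝒯, x(t₀) = 0, y(t) = C_{σ(t)}(t)x(t), over all admissible switching signals σ with arbitrary (unknown) finite resetting-time sets 𝒯 ⊂ Ω. Suppose there exists a positive definite, continuously differentiable matrix-valued function P : Ω → ℝ^{n×n} such that for every i ∈ 𝒫 and every t ∈ Ω: (a) the block matrix [[Ṗ(t) + A_i(t)ᵀP(t) + P(t)A_i(t), P(t)G_i(t)], [G_i(t)ᵀP(t), −R(t)]] is negative definite; (b) J(t)ᵀP(t)J(t) − P(t) is negative semidefinite; (c) P(t) − C_i(t)ᵀQ(t)C_i(t) is positive semidefinite. Then the switching system is IO-FTS with respect to (W₂, Q(·), Ω) under arbitrary switching: for every piecewise constant right-continuous switching signal σ : Ω → 𝒫 with a finite set of resetting times, and every w ∈ W₂, the output satisfies y(t)ᵀQ(t)y(t)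 < 1 for all t ∈ Ω. -/
open MeasureTheory Matrix Set Filter

lemma quad_id {n r : ℕ} (A P P' : Matrix (Fin n) (Fin n) ℝ) (G : Matrix (Fin n) (Fin r) ℝ)
    (R : Matrix (Fin r) (Fin r) ℝ) (x : Fin n → ℝ) (w : Fin r → ℝ) :
    Sum.elim x w ⬝ᵥ ((-(Matrix.fromBlocks (P' + Aᵀ * P + P * A) (P * G) (Gᵀ * P) (-R))) *ᵥ
      Sum.elim x w) = w ⬝ᵥ (R *ᵥ w) - ((A *ᵥ x + G *ᵥ w) ⬝ᵥ (P *ᵥ x)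
        + x ⬝ᵥ (P' *ᵥ x + P *ᵥ (A *ᵥ x + G *ᵥ w))) := by
  have e1 : x ⬝ᵥ (Aᵀ *ᵥ (P *ᵥ x)) = (A *ᵥ x) ⬝ᵥ (P *ᵥ x) := by
    rw [dotProduct_mulVec, vecMul_transpose]
  have e2 : w ⬝ᵥ (Gᵀ *ᵥ (P *ᵥ x)) = (G *ᵥ w) ⬝ᵥ (P *ᵥ x) := by
    rw [dotProduct_mulVec, vecMul_transpose]
  simp only [neg_mulVec, fromBlocks_mulVec, dotProduct_neg, Sum.elim_comp_inl, Sum.elim_comp_inr,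
    sumElim_dotProduct_sumElim, add_mulVec, ← mulVec_mulVec, dotProduct_add, mulVec_add,
    add_dotProduct, e1, e2]
  ring

lemma ac_sum {ι : Type*} (S : Finset ι) (f : ι → ℝ → ℝ) {a b : ℝ}
    (h : ∀ i ∈ S, AbsolutelyContinuousOnInterval (f i) a b) :
    AbsolutelyContinuousOnInterval (fun t => ∑ i ∈ S, f i t) a b := by
  classical
  induction S using Finset.induction_on with
  | empty =>
    simp only [Finset.sum_empty]
    exact (contDiffOn_const).absolutelyContinuousOnInterval
  | insert i S hi ih =>
    simp only [Finset.sum_insert hi]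
    exact (h i (by simp)).add (ih fun j hj => h j (by simp [hj]))

lemma ac_of_deriv {p p' : ℝ → ℝ} {a b : ℝ} (hab : a ≤ b) (hc : ContinuousOn p' (Icc a b))
    (hd : ∀ t ∈ Icc a b, HasDerivWithinAt p (p' t) (Icc a b) t) :
    AbsolutelyContinuousOnInterval p a b := by
  obtain ⟨K, hK⟩ := isCompact_Icc.exists_bound_of_continuousOn hc
  have : LipschitzOnWith K.toNNReal p (Icc a b) := by
    refine (convex_Icc a b).lipschitzOnWith_of_nnnorm_hasDerivWithin_le hd fun x hx => ?_
    rw [← NNReal.coe_le_coe]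
    simpa using Or.inl (hK x hx)
  rw [← uIcc_of_le hab] at this
  exact this.absolutelyContinuousOnInterval

lemma flow {n r : ℕ} {s t : ℝ} (hst : s < t)
    (A : ℝ → Matrix (Fin n) (Fin n) ℝ) (G : ℝ → Matrix (Fin n) (Fin r) ℝ)
    (R : ℝ → Matrix (Fin r) (Fin r) ℝ) (P P' : ℝ → Matrix (Fin n) (Fin n) ℝ)
    (hP'cont : ∀ i j, ContinuousOn (fun t => P' t i j) (Icc s t))
    (hPderiv : ∀ u ∈ Icc s t, ∀ i j,
      HasDerivWithinAt (fun s => P s i j) (P' u i j) (Icc s t) u)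
    (hDLMI : ∀ u ∈ Icc s t,
      (-(Matrix.fromBlocks
          (P' u + (A u)ᵀ * P u + P u * A u) (P u * G u)
          ((G u)ᵀ * P u) (-(R u)))).PosDef)
    (w : ℝ → Fin r → ℝ)
    (hw : IntervalIntegrable (fun τ => w τ ⬝ᵥ (R τ *ᵥ w τ)) volume s t)
    (x : ℝ → Fin n → ℝ)
    (hint : IntervalIntegrable (fun τ => A τ *ᵥ x τ + G τ *ᵥ w τ) volume s t)
    (hx : ∀ u ∈ Icc s t, x u = x s + ∫ τ in s..u, (A τ *ᵥ x τ + G τ *ᵥ w τ))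
    (hne : x t ≠ 0) :
    x t ⬝ᵥ (P t *ᵥ x t) < x s ⬝ᵥ (P s *ᵥ x s) + ∫ τ in s..t, w τ ⬝ᵥ (R τ *ᵥ w τ) := by
  set f : ℝ → Fin n → ℝ := fun τ => A τ *ᵥ x τ + G τ *ᵥ w τ with hf
  have hfi : ∀ i, IntervalIntegrable (fun τ => f τ i) volume s t := fun i =>
    ⟨hint.1.eval i, hint.2.eval i⟩
  set X : ℝ → Fin n → ℝ := fun u i => x s i + ∫ τ in s..u, f τ i with hX
  have hXx : ∀ u ∈ Icc s t, X u = x u := by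
    intro u hu
    ext i
    have hiu : IntervalIntegrable f volume s u := hint.mono_set (by
      rw [uIcc_of_le hst.le, uIcc_of_le hu.1]; exact Icc_subset_Icc_right hu.2)
    have := ((ContinuousLinearMap.proj (R := ℝ) (φ := fun _ : Fin n => ℝ) i)).intervalIntegral_comp_comm hiu
    rw [hx u hu]
    simp only [hX, Pi.add_apply]
    congr 1
  have hXac : ∀ i, AbsolutelyContinuousOnInterval (fun u => X u i) s t := fun i =>
    (contDiffOn_const).absolutelyContinuousOnInterval.add
      ((hfi i).absolutelyContinuousOnInterval_intervalIntegral left_mem_uIcc)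
  have hXc : ContinuousOn X (Icc s t) := by
    rw [continuousOn_pi]
    intro i
    have := (hXac i).continuousOn
    rwa [uIcc_of_le hst.le] at this
  have hPac : ∀ i j, AbsolutelyContinuousOnInterval (fun u => P u i j) s t := fun i j =>
    ac_of_deriv hst.le (hP'cont i j) (fun u hu => hPderiv u hu i j)
  set V : ℝ → ℝ := fun u => ∑ i, X u i * ∑ j, P u i j * X u j with hV
  have hVac : AbsolutelyContinuousOnInterval V s t :=
    ac_sum _ _ fun i _ => (hXac i).mul (ac_sum _ _ fun j _ => (hPac i j).mul (hXac j))
  have hVeq : ∀ u ∈ Icc s t, V u = x u ⬝ᵥ (P u *ᵥ x u) := by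
    intro u hu
    simp only [hV, hXx u hu]
    rfl
  have hder : ∀ᵐ u, u ∈ Ioo s t → deriv V u =
      f u ⬝ᵥ (P u *ᵥ x u) + x u ⬝ᵥ (P' u *ᵥ x u + P u *ᵥ f u) := by
    have h1 : ∀ᵐ u, ∀ i, u ∈ uIcc s t → ∀ c ∈ uIcc s t,
        HasDerivAt (fun u => ∫ τ in c..u, f τ i) (f u i) u :=
      ae_all_iff.2 fun i => (hfi i).ae_hasDerivAt_integral
    filter_upwards [h1] with u hu huo
    have huc := Ioo_subset_Icc_self huo
    have hXd : ∀ i, HasDerivAt (fun u => X u i) (f u i) u := fun i =>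
      (hu i (by rwa [uIcc_of_le hst.le]) s left_mem_uIcc).const_add _
    have hPd : ∀ i j, HasDerivAt (fun u => P u i j) (P' u i j) u := fun i j =>
      (hPderiv u huc i j).hasDerivAt (Icc_mem_nhds huo.1 huo.2)
    have : HasDerivAt V (∑ i, (f u i * (∑ j, P u i j * X u j) +
        X u i * ∑ j, (P' u i j * X u j + P u i j * f u j))) u :=
      HasDerivAt.fun_sum fun i _ => (hXd i).fun_mul
        (HasDerivAt.fun_sum fun j _ => (hPd i j).fun_mul (hXd j))
    rw [this.deriv, hXx u huc]
    simp only [dotProduct, mulVec, Pi.add_apply, Finset.sum_add_distrib]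
  set D : ℝ → ℝ := fun u => w u ⬝ᵥ (R u *ᵥ w u) - 
      (f u ⬝ᵥ (P u *ᵥ x u) + x u ⬝ᵥ (P' u *ᵥ x u + P u *ᵥ f u)) with hD
  have hDeq : ∀ u, D u = _ := fun u => (quad_id (A u) (P u) (P' u) (G u) (R u) (x u) (w u)).symm
  have hD0 : ∀ u ∈ Icc s t, 0 ≤ D u := by
    intro u hu
    rw [hDeq]
    simpa using (hDLMI u hu).posSemidef.dotProduct_mulVec_nonneg (Sum.elim (x u) (w u))
  have hDpos : ∀ u ∈ Icc s t, x u ≠ 0 → 0 < D u := by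
    intro u hu hxu
    rw [hDeq]
    have : Sum.elim (x u) (w u) ≠ 0 := fun h => hxu (by
      ext i; simpa using congrFun h (Sum.inl i))
    simpa using (hDLMI u hu).dotProduct_mulVec_pos this
  have haeD : (fun u => w u ⬝ᵥ (R u *ᵥ w u) - deriv V u) =ᵐ[volume.restrict (uIoc s t)] D := by
    rw [uIoc_of_le hst.le, ← restrict_Ioo_eq_restrict_Ioc]
    rw [EventuallyEq, ae_restrict_iff' measurableSet_Ioo]
    filter_upwards [hder] with u hu huo
    rw [hu huo]
  have hDint : IntervalIntegrable D volume s t :=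
    (hw.sub hVac.intervalIntegrable_deriv).congr_ae haeD
  have hI : ∫ u in s..t, D u = (∫ τ in s..t, w τ ⬝ᵥ (R τ *ᵥ w τ)) - (V t - V s) := by
    rw [← hVac.integral_deriv_eq_sub, ← intervalIntegral.integral_sub hw
      hVac.intervalIntegrable_deriv]
    exact (intervalIntegral.integral_congr_ae_restrict haeD).symm
  rw [hVeq t (right_mem_Icc.2 hst.le), hVeq s (left_mem_Icc.2 hst.le)] at hI
  have hev : ∀ᶠ c in nhdsWithin t (Icc s t), X c ≠ 0 :=
    (hXc t (right_mem_Icc.2 hst.le)).eventually_ne (by rwa [hXx t (right_mem_Icc.2 hst.le)])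
  obtain ⟨c, hc, hcX⟩ : ∃ c ∈ Ico s t, ∀ u ∈ Ioc c t, X u ≠ 0 := by
    rw [nhdsWithin_Icc_eq_nhdsLE hst] at hev
    obtain ⟨c, hc, h⟩ := (mem_nhdsLE_iff_exists_Ioc_subset' hst).1 hev
    exact ⟨max c s, ⟨le_max_right _ _, max_lt hc hst⟩, fun u hu => h ⟨(le_max_left _ _).trans_lt hu.1, hu.2⟩⟩
  have hsc : IntervalIntegrable D volume s c := hDint.mono_set (by
    rw [uIcc_of_le hst.le, uIcc_of_le hc.1]; exact Icc_subset_Icc_right hc.2.le)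
  have hct : IntervalIntegrable D volume c t := hDint.mono_set (by
    rw [uIcc_of_le hst.le, uIcc_of_le hc.2.le]; exact Icc_subset_Icc_left hc.1)
  have i1 : 0 ≤ ∫ u in s..c, D u := intervalIntegral.integral_nonneg hc.1 fun u hu =>
    hD0 u ⟨hu.1, hu.2.trans hc.2.le⟩
  have i2 : 0 < ∫ u in c..t, D u := intervalIntegral.intervalIntegral_pos_of_pos_on hct
    (fun u hu => by
      have hu' : u ∈ Icc s t := ⟨hc.1.trans hu.1.le, hu.2.le⟩
      exact hDpos u hu' (by rw [← hXx u hu']; exact hcX u ⟨hu.1, hu.2.le⟩)) hc.2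
  have := intervalIntegral.integral_add_adjacent_intervals hsc hct
  linarith

/-- **IO-FTS of time-dependent switching linear systems under arbitrary switching.**
If a positive definite continuously differentiable `P(·)` satisfies, for every mode
`i ∈ 𝒫` and every `t ∈ Ω`, (a) the DLMI, (b) `J(t)ᵀP(t)J(t) − P(t) ≤ 0`, and
(c) `P(t) − C_iᵀQC_i ≥ 0`, then for every admissible switching signal `σ` with an
arbitrary finite set of resetting times and every `w ∈ W₂`, the output of
`ẋ = A_{σ(t)} x + G_{σ(t)} w` (`t ∉ 𝒯`), `x(t⁺) = J(t)x(t)` (`t ∈ 𝒯`), `x(t₀) = 0`,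
`y = C_{σ(t)} x` satisfies `y(t)ᵀQ(t)y(t) < 1` on `Ω`. -/
theorem io_fts_switching_arbitrary_switching
    {n r m l : ℕ} (hl : 0 < l) (t₀ T : ℝ) (hT : 0 < T)
    (A : Fin l → ℝ → Matrix (Fin n) (Fin n) ℝ)
    (G : Fin l → ℝ → Matrix (Fin n) (Fin r) ℝ)
    (C : Fin l → ℝ → Matrix (Fin m) (Fin n) ℝ)
    (J : ℝ → Matrix (Fin n) (Fin n) ℝ)
    (R : ℝ → Matrix (Fin r) (Fin r) ℝ)
    (Q : ℝ → Matrix (Fin m) (Fin m) ℝ)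
    (hA : ∀ p i j, ContinuousOn (fun t => A p t i j) (Icc t₀ (t₀ + T)))
    (hG : ∀ p i j, ContinuousOn (fun t => G p t i j) (Icc t₀ (t₀ + T)))
    (hC : ∀ p i j, ContinuousOn (fun t => C p t i j) (Icc t₀ (t₀ + T)))
    (hR : ∀ i j, ContinuousOn (fun t => R t i j) (Icc t₀ (t₀ + T)))
    (hQ : ∀ i j, ContinuousOn (fun t => Q t i j) (Icc t₀ (t₀ + T)))
    (hRpd : ∀ t ∈ Icc t₀ (t₀ + T), (R t).PosDef)
    (hQpd : ∀ t ∈ Icc t₀ (t₀ + T), (Q t).PosDef)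
    -- `P` positive definite and continuously differentiable (with derivative `P'`)
    (P P' : ℝ → Matrix (Fin n) (Fin n) ℝ)
    (hPpd : ∀ t ∈ Icc t₀ (t₀ + T), (P t).PosDef)
    (hP'cont : ∀ i j, ContinuousOn (fun t => P' t i j) (Icc t₀ (t₀ + T)))
    (hPderiv : ∀ t ∈ Icc t₀ (t₀ + T), ∀ i j,
      HasDerivWithinAt (fun s => P s i j) (P' t i j) (Icc t₀ (t₀ + T)) t)
    -- (a): the DLMI for every mode
    (hDLMI : ∀ i : Fin l, ∀ t ∈ Icc t₀ (t₀ + T),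
      (-(Matrix.fromBlocks
          (P' t + (A i t)ᵀ * P t + P t * A i t) (P t * G i t)
          ((G i t)ᵀ * P t) (-(R t)))).PosDef)
    -- (b): `J(t)ᵀ P(t) J(t) − P(t) ≤ 0` on `Ω`
    (hJump : ∀ t ∈ Icc t₀ (t₀ + T), (P t - (J t)ᵀ * P t * J t).PosSemidef)
    -- (c): `P(t) ≥ C_iᵀ Q C_i` on `Ω` for every mode
    (hLMI : ∀ i : Fin l, ∀ t ∈ Icc t₀ (t₀ + T),
      (P t - (C i t)ᵀ * Q t * C i t).PosSemidef) :
    -- IO-FTS under arbitrary switching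
    ∀ (h : ℕ) (ts : ℕ → ℝ),
      StrictMonoOn ts (Icc 1 h) →
      (∀ k, 1 ≤ k → k ≤ h → ts k ∈ Ioc t₀ (t₀ + T)) →
      ∀ σ : ℝ → Fin l,
        (∀ s t : ℝ, s ∈ Icc t₀ (t₀ + T) → t ∈ Icc t₀ (t₀ + T) → s ≤ t →
          (∀ k, 1 ≤ k → k ≤ h → ts k ∉ Ioc s t) → σ s = σ t) →
        ∀ w : ℝ → Fin r → ℝ, Measurable w →
          IntervalIntegrable (fun τ => w τ ⬝ᵥ (R τ *ᵥ w τ)) volume t₀ (t₀ + T) →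
          (∫ τ in t₀..(t₀ + T), w τ ⬝ᵥ (R τ *ᵥ w τ)) ≤ 1 →
          ∀ (x : ℝ → Fin n → ℝ) (xL : ℕ → (Fin n → ℝ)),
            x t₀ = 0 →
            -- flow between consecutive resetting times
            (∀ s t : ℝ, s ∈ Icc t₀ (t₀ + T) → t ∈ Icc t₀ (t₀ + T) → s ≤ t →
              (∀ k, 1 ≤ k → k ≤ h → ts k ∉ Ioc s t) →
              IntervalIntegrable (fun τ => A (σ τ) τ *ᵥ x τ + G (σ τ) τ *ᵥ w τ)
                volume s t ∧
              x t = x s + ∫ τ in s..t, (A (σ τ) τ *ᵥ x τ + G (σ τ) τ *ᵥ w τ)) →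
            -- jumps: `xL k` is the left limit at `ts k` and the state jumps through `J`
            (∀ k, 1 ≤ k → k ≤ h →
              Tendsto x (nhdsWithin (ts k) (Iio (ts k))) (nhds (xL k)) ∧
              x (ts k) = J (ts k) *ᵥ xL k) →
            ∀ t ∈ Icc t₀ (t₀ + T),
              (C (σ t) t *ᵥ x t) ⬝ᵥ (Q t *ᵥ (C (σ t) t *ᵥ x t)) < 1 := by
  intro h ts hmono hts σ hσ w hwm hwint hw1 x xL hx0 hflow hjump
  set q : ℝ → ℝ := fun τ => w τ ⬝ᵥ (R τ *ᵥ w τ) with hq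
  have hq0 : ∀ u ∈ Icc t₀ (t₀ + T), 0 ≤ q u := fun u hu => by
    simpa using (hRpd u hu).posSemidef.dotProduct_mulVec_nonneg (w u)
  have hqi : ∀ s ∈ Icc t₀ (t₀ + T), ∀ t ∈ Icc t₀ (t₀ + T), IntervalIntegrable q volume s t :=
    fun s hs t ht => hwint.mono_set (by
      rw [uIcc_of_le (by linarith : t₀ ≤ t₀ + T)]
      exact ordConnected_Icc.uIcc_subset hs ht)
  have h0mem : t₀ ∈ Icc t₀ (t₀ + T) := ⟨le_rfl, by linarith⟩
  have hadd : ∀ s ∈ Icc t₀ (t₀ + T), ∀ t ∈ Icc t₀ (t₀ + T),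
      (∫ τ in t₀..t, q τ) = (∫ τ in t₀..s, q τ) + ∫ τ in s..t, q τ := fun s hs t ht =>
    (intervalIntegral.integral_add_adjacent_intervals (hqi _ h0mem _ hs) (hqi _ hs _ ht)).symm
  have hI0 : ∀ s ∈ Icc t₀ (t₀ + T), 0 ≤ ∫ τ in t₀..s, q τ := fun s hs =>
    intervalIntegral.integral_nonneg hs.1 fun u hu => hq0 u ⟨hu.1, hu.2.trans hs.2⟩
  -- strict decrease along a flow piece
  have hstep : ∀ s t : ℝ, s ∈ Icc t₀ (t₀ + T) → t ∈ Icc t₀ (t₀ + T) → s < t →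
      (∀ k, 1 ≤ k → k ≤ h → ts k ∉ Ioc s t) → x t ≠ 0 →
      x t ⬝ᵥ (P t *ᵥ x t) < x s ⬝ᵥ (P s *ᵥ x s) + ∫ τ in s..t, q τ := by
    intro s t hs ht hst hno hne
    have hsub : Icc s t ⊆ Icc t₀ (t₀ + T) := Icc_subset_Icc hs.1 ht.2
    have hsig : ∀ u ∈ Icc s t, σ u = σ s := fun u hu =>
      (hσ s u hs (hsub hu) hu.1 fun k h1 h2 h3 => hno k h1 h2 ⟨h3.1, h3.2.trans hu.2⟩).symm
    have hcong : ∀ u ∈ Icc s t, ∀ τ ∈ uIcc s u,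
        A (σ τ) τ *ᵥ x τ + G (σ τ) τ *ᵥ w τ = A (σ s) τ *ᵥ x τ + G (σ s) τ *ᵥ w τ := by
      intro u hu τ hτ
      rw [uIcc_of_le hu.1] at hτ
      rw [hsig τ ⟨hτ.1, hτ.2.trans hu.2⟩]
    refine flow hst (A (σ s)) (G (σ s)) R P P' (fun i j => (hP'cont i j).mono hsub)
      (fun u hu i j => (hPderiv u (hsub hu) i j).mono hsub)
      (fun u hu => hDLMI (σ s) u (hsub hu)) w (hqi _ hs _ ht) x ?_ ?_ hne
    · refine (hflow s t hs ht hst.le hno).1.congr fun τ hτ => ?_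
      exact hcong t (right_mem_Icc.2 hst.le) τ (uIoc_subset_uIcc hτ)
    · intro u hu
      rw [(hflow s u hs (hsub hu) hu.1 fun k h1 h2 h3 => hno k h1 h2 ⟨h3.1, h3.2.trans hu.2⟩).2]
      congr 1
      exact intervalIntegral.integral_congr (hcong u hu)
  have hgood : ∀ s t : ℝ, s ∈ Icc t₀ (t₀ + T) → t ∈ Icc t₀ (t₀ + T) → s ≤ t →
      (∀ k, 1 ≤ k → k ≤ h → ts k ∉ Ioc s t) →
      (x s = 0 ∨ x s ⬝ᵥ (P s *ᵥ x s) < ∫ τ in t₀..s, q τ) →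
      (x t = 0 ∨ x t ⬝ᵥ (P t *ᵥ x t) < ∫ τ in t₀..t, q τ) := by
    intro s t hs ht hst hno hg
    rcases hst.eq_or_lt with rfl | hlt
    · exact hg
    by_cases hne : x t = 0
    · exact Or.inl hne
    right
    have h1 := hstep s t hs ht hlt hno hne
    have h2 := hadd s hs t ht
    have h3 : x s ⬝ᵥ (P s *ᵥ x s) ≤ ∫ τ in t₀..s, q τ := by
      rcases hg with hg | hg
      · simpa [hg] using hI0 s hs
      · exact hg.le
    linarith
  have hPc : ∀ i j, ContinuousOn (fun s => P s i j) (Icc t₀ (t₀ + T)) := fun i j u hu =>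
    (hPderiv u hu i j).continuousWithinAt
  -- behaviour across a jump
  have hjmp : ∀ k, 1 ≤ k → k ≤ h →
      (∀ c ∈ Ico t₀ (ts k), x c = 0 ∨ x c ⬝ᵥ (P c *ᵥ x c) < ∫ τ in t₀..c, q τ) →
      (x (ts k) = 0 ∨ x (ts k) ⬝ᵥ (P (ts k) *ᵥ x (ts k)) < ∫ τ in t₀..ts k, q τ) := by
    intro k hk1 hkh hg
    obtain ⟨hlim, hJ⟩ := hjump k hk1 hkh
    have hb := hts k hk1 hkh
    set b := ts k with hbdef
    have hbm : b ∈ Icc t₀ (t₀ + T) := ⟨hb.1.le, hb.2⟩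
    by_cases hxL : xL k = 0
    · left; rw [hJ, hxL, mulVec_zero]
    right
    have hVJ : x b ⬝ᵥ (P b *ᵥ x b) ≤ xL k ⬝ᵥ (P b *ᵥ xL k) := by
      have := (hJump b hbm).dotProduct_mulVec_nonneg (xL k)
      rw [hJ]
      have e : xL k ⬝ᵥ ((J b)ᵀ *ᵥ (P b *ᵥ (J b *ᵥ xL k))) =
          (J b *ᵥ xL k) ⬝ᵥ (P b *ᵥ (J b *ᵥ xL k)) := by
        rw [dotProduct_mulVec, vecMul_transpose]
      simp only [star_trivial, sub_mulVec, dotProduct_sub, ← mulVec_mulVec, e] at this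
      linarith
    have hno : ∀ᶠ c in nhdsWithin b (Iio b), ∀ j ∈ Finset.Icc 1 h, ts j ∉ Ioo c b := by
      rw [Filter.eventually_all_finset]
      intro j _
      by_cases hj : ts j < b
      · filter_upwards [Ioo_mem_nhdsLT hj] with c hc hcc
        exact absurd hc.1 (not_lt.2 hcc.1.le)
      · exact Eventually.of_forall fun c hcc => hj hcc.2
    have hIoo : ∀ᶠ c in nhdsWithin b (Iio b), c ∈ Ioo t₀ b := Ioo_mem_nhdsLT hb.1
    obtain ⟨c, ⟨hcne, hcno⟩, hc⟩ := (((hlim.eventually_ne hxL).and hno).and hIoo).exists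
    have hcm : c ∈ Icc t₀ (t₀ + T) := ⟨hc.1.le, hc.2.le.trans hb.2⟩
    have hVc := (hg c ⟨hc.1.le, hc.2⟩).resolve_left hcne
    have hle : xL k ⬝ᵥ (P b *ᵥ xL k) ≤ x c ⬝ᵥ (P c *ᵥ x c) + ∫ τ in c..b, q τ := by
      have hxi : ∀ i, Tendsto (fun u => x u i) (nhdsWithin b (Iio b)) (nhds (xL k i)) :=
        fun i => (tendsto_pi_nhds.1 hlim) i
      have hPi : ∀ i j, Tendsto (fun u => P u i j) (nhdsWithin b (Iio b)) (nhds (P b i j)) := by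
        intro i j
        have h1 := hPc i j b hbm
        refine h1.tendsto.mono_left ?_
        rw [← nhdsWithin_Ioo_eq_nhdsLT hb.1]
        exact nhdsWithin_mono _ fun u hu => ⟨hu.1.le, hu.2.le.trans hb.2⟩
      have t1 : Tendsto (fun u => x u ⬝ᵥ (P u *ᵥ x u)) (nhdsWithin b (Iio b))
          (nhds (xL k ⬝ᵥ (P b *ᵥ xL k))) := by
        simp only [dotProduct, mulVec]
        exact tendsto_finsetSum _ fun i _ => (hxi i).mul
          (tendsto_finsetSum _ fun j _ => (hPi i j).mul (hxi j))
      refine le_of_tendsto t1 ?_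
      filter_upwards [Ioo_mem_nhdsLT hc.2, hlim.eventually_ne hxL] with u hu hune
      have hum : u ∈ Icc t₀ (t₀ + T) := ⟨hcm.1.trans hu.1.le, hu.2.le.trans hb.2⟩
      have h1 := hstep c u hcm hum hu.1 (fun j hj1 hjh hj => hcno j (Finset.mem_Icc.2 ⟨hj1, hjh⟩)
        ⟨hj.1, hj.2.trans_lt hu.2⟩) hune
      have h2 : 0 ≤ ∫ τ in u..b, q τ := intervalIntegral.integral_nonneg hu.2.le fun v hv =>
        hq0 v ⟨hum.1.trans hv.1, hv.2.trans hb.2⟩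
      have h3 := intervalIntegral.integral_add_adjacent_intervals (hqi c hcm u hum)
        (hqi u hum b hbm)
      linarith
    have := hadd c hcm b hbm
    linarith
  have hind : ∀ k ≤ h, ∀ t ∈ Icc t₀ (t₀ + T), (∀ j, k < j → j ≤ h → t < ts j) →
      (x t = 0 ∨ x t ⬝ᵥ (P t *ᵥ x t) < ∫ τ in t₀..t, q τ) := by
    intro k
    induction k with
    | zero =>
      intro _ t ht hj
      exact hgood t₀ t h0mem ht ht.1 (fun j h1 h2 h3 => absurd (hj j h1 h2) (not_lt.2 h3.2))
        (Or.inl hx0)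
    | succ k ih =>
      intro hk t ht hj
      have hb := hts (k + 1) (by omega) hk
      by_cases hlt : t < ts (k + 1)
      · refine ih (by omega) t ht fun j h1 h2 => ?_
        rcases Nat.eq_or_lt_of_le h1 with rfl | h1
        · exact hlt
        · exact hj j h1 h2
      · refine hgood (ts (k + 1)) t ⟨hb.1.le, hb.2⟩ ht (not_lt.1 hlt) ?_ ?_
        · intro j h1 h2 h3
          by_cases hjk : j ≤ k + 1
          · exact absurd h3.1 (not_lt.2 (hmono.monotoneOn ⟨h1, h2⟩ ⟨by omega, hk⟩ hjk))
          · exact absurd (hj j (by omega) h2) (not_lt.2 h3.2)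
        · refine hjmp (k + 1) (by omega) hk fun c hc => ?_
          refine ih (by omega) c ⟨hc.1, hc.2.le.trans hb.2⟩ fun j h1 h2 => ?_
          exact hc.2.trans_le (hmono.monotoneOn ⟨by omega, hk⟩ ⟨by omega, h2⟩ h1)
  intro t ht
  have hC' : (C (σ t) t *ᵥ x t) ⬝ᵥ (Q t *ᵥ (C (σ t) t *ᵥ x t)) ≤ x t ⬝ᵥ (P t *ᵥ x t) := by
    have := (hLMI (σ t) t ht).dotProduct_mulVec_nonneg (x t)
    have e : x t ⬝ᵥ ((C (σ t) t)ᵀ *ᵥ (Q t *ᵥ (C (σ t) t *ᵥ x t))) =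
        (C (σ t) t *ᵥ x t) ⬝ᵥ (Q t *ᵥ (C (σ t) t *ᵥ x t)) := by
      rw [dotProduct_mulVec, vecMul_transpose]
    simp only [star_trivial, sub_mulVec, dotProduct_sub, ← mulVec_mulVec, e] at this
    linarith
  rcases hind h le_rfl t ht (fun j h1 h2 => absurd h1 (by omega)) with h0 | hlt
  · simp [h0]
  · have h2 := hadd t ht (t₀ + T) ⟨by linarith, le_rfl⟩
    have h3 : 0 ≤ ∫ τ in t..(t₀ + T), q τ := intervalIntegral.integral_nonneg ht.2 fun v hv =>
      hq0 v ⟨ht.1.trans hv.1, hv.2⟩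
    linarith
end
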